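/- arXiv:1903.05418 — 3 statements merged into one kernel-verified Lean document; each statement's English description precedes it below -/
import Mathlib

section
/- With F := J − AH for a given A ∈ ℝ^{ℓn×ℓ}, the matrix zI − F is invertible over the field ℝ(z) of real rational functions, and if moreover det A(z) ≠ 0 in ℝ(z), then H(zI − F)⁻¹ = A(z)⁻¹ Π(z) as ℓ×ℓn matrices over ℝ(z). -/
open Matrix

set_option synthInstance.maxHeartbeats 1000000
set_option maxHeartbeats 1000000

noncomputable section

/-- Row/column index set for the block structure given by observability indices `t`. -/
abbrev Idx (ℓ : ℕ) (t : Fin ℓ → ℕ) := (i : Fin ℓ) × Fin (t i)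

/-- `J = diag(J_{t₁},…,J_{t_ℓ})`, block diagonal of shift matrices (ones on superdiagonal). -/
def Jmat (ℓ : ℕ) (t : Fin ℓ → ℕ) : Matrix (Idx ℓ t) (Idx ℓ t) ℝ :=
  Matrix.of fun x y =>
    if x.1 = y.1 ∧ (x.2 : ℕ) + 1 = (y.2 : ℕ) then 1 else 0

/-- `H = diag(h_{t₁},…,h_{t_ℓ})` with `h_ν = (1,0,…,0)`. -/
def Hmat (ℓ : ℕ) (t : Fin ℓ → ℕ) : Matrix (Fin ℓ) (Idx ℓ t) ℝ :=
  Matrix.of fun a y => if a = y.1 ∧ (y.2 : ℕ) = 0 then 1 else 0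

/-- `Π(w) = diag(π_{t₁}(w),…,π_{t_ℓ}(w))` with `π_ν(w) = (w^{ν-1},…,w,1)`,
over the field of rational functions. -/
def PiMat (ℓ : ℕ) (t : Fin ℓ → ℕ) (w : RatFunc ℝ) :
    Matrix (Fin ℓ) (Idx ℓ t) (RatFunc ℝ) :=
  Matrix.of fun a y => if a = y.1 then w ^ (t y.1 - 1 - (y.2 : ℕ)) else 0

/-- `D(w) = diag(w^{t₁},…,w^{t_ℓ})`. -/
def Dmat (ℓ : ℕ) (t : Fin ℓ → ℕ) (w : RatFunc ℝ) :
    Matrix (Fin ℓ) (Fin ℓ) (RatFunc ℝ) :=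
  Matrix.diagonal fun a => w ^ (t a)

/-- For `X ∈ ℝ^{ℓn×ℓ}`, the matrix polynomial `X(w) := D(w) + Π(w)X`. -/
def matPoly (ℓ : ℕ) (t : Fin ℓ → ℕ) (X : Matrix (Idx ℓ t) (Fin ℓ) ℝ)
    (w : RatFunc ℝ) : Matrix (Fin ℓ) (Fin ℓ) (RatFunc ℝ) :=
  Dmat ℓ t w + PiMat ℓ t w * X.map (fun r => RatFunc.C r)

/-- For a matrix `F` over `ℝ`, the matrix `zI - F` is invertible over the rational functions. -/
theorem isUnit_X_smul_one_sub_map {ι : Type*} [Fintype ι] [DecidableEq ι] (F : Matrix ι ι ℝ) :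
    IsUnit ((RatFunc.X : RatFunc ℝ) • (1 : Matrix ι ι (RatFunc ℝ)) -
      F.map (fun r => RatFunc.C r)) := by
  have h : (RatFunc.X : RatFunc ℝ) • (1 : Matrix ι ι (RatFunc ℝ)) -
      F.map (fun r => RatFunc.C r) =
      (algebraMap (Polynomial ℝ) (RatFunc ℝ)).mapMatrix F.charmatrix := by
    ext i j
    by_cases hij : i = j
    · subst hij
      simp
    · simp [hij]
  rw [h, Matrix.isUnit_iff_isUnit_det, ← RingHom.map_det, isUnit_iff_ne_zero]
  exact RatFunc.algebraMap_ne_zero (Matrix.charpoly_monic F).ne_zero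

/-- `Π(w) (wI - J) = D(w) H`, in additive form. -/
theorem smul_PiMat_eq (ℓ : ℕ) (t : Fin ℓ → ℕ) (w : RatFunc ℝ) :
    w • PiMat ℓ t w = PiMat ℓ t w * (Jmat ℓ t).map (fun r => RatFunc.C r) +
      Dmat ℓ t w * (Hmat ℓ t).map (fun r => RatFunc.C r) := by
  ext a ⟨i, k, hk⟩
  rw [Matrix.add_apply, Dmat, Matrix.diagonal_mul, Matrix.mul_apply]
  rcases k with _ | k
  · have hsum : ∑ x, PiMat ℓ t w a x *
        (Jmat ℓ t).map (fun r => RatFunc.C r) x ⟨i, 0, hk⟩ = 0 :=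
      Finset.sum_eq_zero fun x _ => by simp [Jmat]
    rw [hsum]
    by_cases h : a = i
    · subst h
      simp [PiMat, Hmat, ← pow_succ', Nat.sub_add_cancel hk]
    · simp [PiMat, Hmat, h]
  · rw [Finset.sum_eq_single ⟨i, k, by omega⟩]
    · by_cases h : a = i
      · subst h
        have e : t a - 1 - (k + 1) + 1 = t a - 1 - k := by omega
        simp [PiMat, Hmat, Jmat, ← pow_succ', e]
      · simp [PiMat, Hmat, h]
    · rintro ⟨i', k', hk'⟩ _ hne
      have hJ : ¬ (i' = i ∧ k' + 1 = k + 1) := by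
        rintro ⟨rfl, h⟩
        obtain rfl : k' = k := by omega
        exact hne rfl
      simp only [Matrix.map_apply, Jmat, Matrix.of_apply, if_neg hJ, map_zero, mul_zero]
    · simp

/-- `Π(w) (wI - (J - X H)) = X(w) H`. -/
theorem PiMat_mul_sub (ℓ : ℕ) (t : Fin ℓ → ℕ) (X : Matrix (Idx ℓ t) (Fin ℓ) ℝ)
    (w : RatFunc ℝ) :
    PiMat ℓ t w * (w • (1 : Matrix (Idx ℓ t) (Idx ℓ t) (RatFunc ℝ)) -
        (Jmat ℓ t - X * Hmat ℓ t).map (fun r => RatFunc.C r)) =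
      matPoly ℓ t X w * (Hmat ℓ t).map (fun r => RatFunc.C r) := by
  have hF : (Jmat ℓ t - X * Hmat ℓ t).map (fun r => (RatFunc.C r : RatFunc ℝ)) =
      (Jmat ℓ t).map (fun r => RatFunc.C r) -
        X.map (fun r => RatFunc.C r) * (Hmat ℓ t).map (fun r => RatFunc.C r) := by
    ext i j
    simp [Matrix.mul_apply]
  rw [hF, Matrix.mul_sub, Matrix.mul_smul, Matrix.mul_one, smul_PiMat_eq, matPoly,
    Matrix.mul_sub, Matrix.add_mul, Matrix.mul_assoc]
  abel

/-- With `F := J − AH`, the matrix `zI − F` is invertible over `ℝ(z)`,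
and if `det A(z) ≠ 0` then `H(zI − F)⁻¹ = A(z)⁻¹ Π(z)`. -/
theorem stmt0 (ℓ n : ℕ) (hℓ : 1 ≤ ℓ) (hn : 1 ≤ n) (t : Fin ℓ → ℕ)
    (ht : ∀ i, 1 ≤ t i) (htsum : ∑ i, t i = ℓ * n)
    (A : Matrix (Idx ℓ t) (Fin ℓ) ℝ) :
    IsUnit ((RatFunc.X : RatFunc ℝ) • (1 : Matrix (Idx ℓ t) (Idx ℓ t) (RatFunc ℝ)) -
        (Jmat ℓ t - A * Hmat ℓ t).map (fun r => RatFunc.C r)) ∧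
      ((matPoly ℓ t A RatFunc.X).det ≠ 0 →
        (Hmat ℓ t).map (fun r => RatFunc.C r) *
            ((RatFunc.X : RatFunc ℝ) • (1 : Matrix (Idx ℓ t) (Idx ℓ t) (RatFunc ℝ)) -
              (Jmat ℓ t - A * Hmat ℓ t).map (fun r => RatFunc.C r))⁻¹ =
          (matPoly ℓ t A RatFunc.X)⁻¹ * PiMat ℓ t RatFunc.X) := by
  refine ⟨isUnit_X_smul_one_sub_map _, fun hdet => ?_⟩
  have hU := (Matrix.isUnit_iff_isUnit_det _).mp
    (isUnit_X_smul_one_sub_map (Jmat ℓ t - A * Hmat ℓ t))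
  have hP := PiMat_mul_sub ℓ t A RatFunc.X
  generalize (RatFunc.X : RatFunc ℝ) • (1 : Matrix (Idx ℓ t) (Idx ℓ t) (RatFunc ℝ)) -
    (Jmat ℓ t - A * Hmat ℓ t).map (fun r => RatFunc.C r) = M at hU hP ⊢
  rw [← Matrix.nonsing_inv_mul_cancel_left _ ((Hmat ℓ t).map fun r => RatFunc.C r)
    hdet.isUnit, ← hP, Matrix.mul_assoc, Matrix.mul_nonsing_inv_cancel_right _ _ hU]
end
end

section
/- Let E be an N×N Hermitian positive-definite complex matrix and let W be an N×N complex matrix such that W + ½I is invertible and the Hermitian matrix WE + EW* is positive definite (* denoting conjugate transpose). Set T := (W − ½I)(W + ½I)⁻¹. Then for every real λ ∈ [0,1], the matrix I − λT is invertible and, with W(λ) := (I − λT)⁻¹ − ½I, the Hermitian matrix W(λ)E + E W(λ)* is positive definite. -/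
open Matrix ComplexOrder

noncomputable section

namespace Matrix

variable {n : Type*} [Fintype n] [DecidableEq n] {E M : Matrix n n ℂ}

/-- The defect `E - (1 - M) E (1 - M)ᴴ` of `1 - M` is positive definite only if `M` is
invertible. -/
lemma isUnit_of_posDef_defect (h : (M * E + E * Mᴴ - M * E * Mᴴ).PosDef) : IsUnit M := by
  rw [← isUnit_conjTranspose, ← mulVec_injective_iff_isUnit,
    ← coe_mulVecLin, ← LinearMap.ker_eq_bot, LinearMap.ker_eq_bot']
  intro x hx
  rw [mulVecLin_apply] at hx
  by_contra hx0
  have hpos := h.dotProduct_mulVec_pos hx0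
  have hx' : star x ᵥ* M = 0 := by
    simpa [star_mulVec] using congrArg star hx
  simp only [sub_mulVec, add_mulVec, ← mulVec_mulVec, hx, mulVec_zero, add_zero, sub_zero,
    dotProduct_mulVec, hx', zero_vecMul, zero_dotProduct, lt_irrefl] at hpos

/-- Conjugating the defect of `1 - M` by `M⁻¹` gives the Hermitian form of `M⁻¹ - ½`. -/
lemma posDef_defect_iff (hM : IsUnit M) :
    ((M⁻¹ - (2 : ℂ)⁻¹ • 1) * E + E * (M⁻¹ - (2 : ℂ)⁻¹ • 1)ᴴ).PosDef ↔
      (M * E + E * Mᴴ - M * E * Mᴴ).PosDef := by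
  rw [← IsUnit.posDef_star_right_conjugate_iff hM, star_eq_conjTranspose]
  have hdet := (isUnit_iff_isUnit_det M).mp hM
  have hleft : M * M⁻¹ = 1 := mul_nonsing_inv M hdet
  have hright : M⁻¹ᴴ * Mᴴ = 1 := by
    rw [← conjTranspose_mul, hleft, conjTranspose_one]
  have hhalf : ((2 : ℂ)⁻¹ • (1 : Matrix n n ℂ))ᴴ = (2 : ℂ)⁻¹ • 1 := by
    simp [conjTranspose_smul]
  have key : M * ((M⁻¹ - (2 : ℂ)⁻¹ • 1) * E + E * (M⁻¹ - (2 : ℂ)⁻¹ • 1)ᴴ) * Mᴴ =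
      M * E + E * Mᴴ - M * E * Mᴴ := by
    calc _ = (M * M⁻¹) * E * Mᴴ + M * E * (M⁻¹ᴴ * Mᴴ) - M * E * Mᴴ := by
          rw [conjTranspose_sub, hhalf]
          simp only [sub_mul, mul_sub, mul_add, add_mul, smul_mul_assoc, mul_smul_comm, one_mul,
            mul_one, ← mul_assoc]
          module
      _ = _ := by rw [hleft, hright, one_mul, mul_one]; abel
  rw [key]

/-- Positive definiteness of the defect of `T` persists under scaling `T` by `r ∈ [0, 1]`. -/
lemma PosDef.defect_smul (hE : E.PosDef) {T : Matrix n n ℂ} (hT : (E - T * E * Tᴴ).PosDef)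
    {r : ℝ} (hr : r ∈ Set.Icc (0 : ℝ) 1) :
    (E - ((r : ℂ) • T) * E * ((r : ℂ) • T)ᴴ).PosDef := by
  have hconv : E - ((r : ℂ) • T) * E * ((r : ℂ) • T)ᴴ =
      (1 - r ^ 2 : ℝ) • E + (r ^ 2 : ℝ) • (E - T * E * Tᴴ) := by
    ext i j
    simp [conjTranspose_smul, smul_smul]
    ring
  rw [hconv]
  have hsq : r ^ 2 ≤ 1 := pow_le_one₀ hr.1 hr.2
  rcases hsq.lt_or_eq with hlt | heq
  · exact (hE.smul (sub_pos.mpr hlt)).add_posSemidef (hT.posSemidef.smul (sq_nonneg r))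
  · simpa [heq] using hT

lemma defect_one_sub (T E : Matrix n n ℂ) :
    (1 - T) * E + E * (1 - T)ᴴ - (1 - T) * E * (1 - T)ᴴ = E - T * E * Tᴴ := by
  rw [conjTranspose_sub, conjTranspose_one]
  noncomm_ring

end Matrix

/-- If `E ≻ 0`, `W + ½I` is invertible and `WE + EW* ≻ 0`, then with
`T := (W − ½I)(W + ½I)⁻¹`, for every `λ ∈ [0,1]` the matrix `I − λT` is invertible and
`W(λ)E + E W(λ)* ≻ 0`, where `W(λ) := (I − λT)⁻¹ − ½I`. -/
theorem stmt8 (N : ℕ) (E W : Matrix (Fin N) (Fin N) ℂ)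
    (hE : E.PosDef)
    (hWinv : IsUnit (W + (2 : ℂ)⁻¹ • (1 : Matrix (Fin N) (Fin N) ℂ)))
    (hPick : (W * E + E * Wᴴ).PosDef) :
    ∀ lam : ℝ, lam ∈ Set.Icc (0 : ℝ) 1 →
      IsUnit ((1 : Matrix (Fin N) (Fin N) ℂ) -
          (lam : ℂ) • ((W - (2 : ℂ)⁻¹ • 1) * (W + (2 : ℂ)⁻¹ • 1)⁻¹)) ∧
      ((((1 : Matrix (Fin N) (Fin N) ℂ) -
            (lam : ℂ) • ((W - (2 : ℂ)⁻¹ • 1) * (W + (2 : ℂ)⁻¹ • 1)⁻¹))⁻¹ - (2 : ℂ)⁻¹ • 1) * E +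
        E * (((1 : Matrix (Fin N) (Fin N) ℂ) -
            (lam : ℂ) • ((W - (2 : ℂ)⁻¹ • 1) * (W + (2 : ℂ)⁻¹ • 1)⁻¹))⁻¹ - (2 : ℂ)⁻¹ • 1)ᴴ).PosDef := by
  intro lam hlam
  set S := W + (2 : ℂ)⁻¹ • (1 : Matrix (Fin N) (Fin N) ℂ) with hS
  set T := (W - (2 : ℂ)⁻¹ • 1) * S⁻¹ with hT
  have hSdet := (isUnit_iff_isUnit_det S).mp hWinv
  have hWS : W = S⁻¹⁻¹ - (2 : ℂ)⁻¹ • 1 := by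
    rw [nonsing_inv_nonsing_inv S hSdet, hS, add_sub_cancel_right]
  have hTS : S⁻¹ = 1 - T := by
    have hW : W - (2 : ℂ)⁻¹ • 1 = S - 1 := by rw [hS]; module
    rw [hT, hW, sub_mul, mul_nonsing_inv S hSdet, one_mul, sub_sub_cancel]
  have hdefect : (E - T * E * Tᴴ).PosDef := by
    rw [hWS, posDef_defect_iff (isUnit_nonsing_inv_iff.mpr hWinv), hTS,
      defect_one_sub] at hPick
    exact hPick
  have hscaled := hE.defect_smul hdefect hlam
  rw [← defect_one_sub] at hscaled
  have hunit := isUnit_of_posDef_defect hscaled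
  exact ⟨hunit, (posDef_defect_iff hunit).mpr hscaled⟩
end
end

section
/- Let P = Pᵀ ∈ ℝ^{N×N} be symmetric, F ∈ ℝ^{N×N}, H ∈ ℝ^{m×N}, G ∈ ℝ^{N×m}, assume I_m − HPHᵀ is invertible, and suppose the algebraic Riccati equation P = FPFᵀ + (G − FPHᵀ)(I_m − HPHᵀ)⁻¹(G − FPHᵀ)ᵀ holds. Define Γ := F − (G − FPHᵀ)(I_m − HPHᵀ)⁻¹H. Then P = Γ(P − PHᵀHP)Γᵀ + GGᵀ. -/
open Matrix

noncomputable section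

/-- From the algebraic Riccati equation
`P = FPFᵀ + (G − FPHᵀ)(I − HPHᵀ)⁻¹(G − FPHᵀ)ᵀ` and
`Γ := F − (G − FPHᵀ)(I − HPHᵀ)⁻¹H`, it follows that `P = Γ(P − PHᵀHP)Γᵀ + GGᵀ`. -/
theorem stmt11 (N m : ℕ)
    (P F : Matrix (Fin N) (Fin N) ℝ) (H : Matrix (Fin m) (Fin N) ℝ)
    (G : Matrix (Fin N) (Fin m) ℝ)
    (hPsym : Pᵀ = P)
    (hinv : IsUnit ((1 : Matrix (Fin m) (Fin m) ℝ) - H * P * Hᵀ))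
    (hric : P = F * P * Fᵀ +
      (G - F * P * Hᵀ) * ((1 : Matrix (Fin m) (Fin m) ℝ) - H * P * Hᵀ)⁻¹ * (G - F * P * Hᵀ)ᵀ)
    (Γ : Matrix (Fin N) (Fin N) ℝ)
    (hΓ : Γ = F - (G - F * P * Hᵀ) * ((1 : Matrix (Fin m) (Fin m) ℝ) - H * P * Hᵀ)⁻¹ * H) :
    P = Γ * (P - P * Hᵀ * H * P) * Γᵀ + G * Gᵀ := by
  set R := (1 : Matrix (Fin m) (Fin m) ℝ) - H * P * Hᵀ with hR
  set L := G - F * P * Hᵀ with hL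
  have hdet : IsUnit R.det := (Matrix.isUnit_iff_isUnit_det R).mp hinv
  obtain ⟨K, hK⟩ : ∃ K, K = L * R⁻¹ := ⟨_, rfl⟩
  rw [← hK] at hric hΓ
  have hKR : K * R = L := by
    rw [hK, Matrix.mul_assoc, Matrix.nonsing_inv_mul R hdet, Matrix.mul_one]
  have hΓPH : Γ * P * Hᵀ = G - K := by
    have hKS : K * (H * P * Hᵀ) = K - L := by
      rw [← hKR, hR, Matrix.mul_sub, Matrix.mul_one, sub_sub_cancel]
    have hexp : Γ * P * Hᵀ = F * P * Hᵀ - K * (H * P * Hᵀ) := by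
      simp only [hΓ, Matrix.sub_mul, Matrix.mul_assoc]
    rw [hexp, hKS, hL]
    abel
  have hHPΓ : H * P * Γᵀ = (G - K)ᵀ := by
    rw [← hΓPH]
    simp only [Matrix.transpose_mul, Matrix.transpose_transpose, hPsym, Matrix.mul_assoc]
  have hHPF : H * P * Fᵀ = Gᵀ - Lᵀ := by
    simp only [hL, Matrix.transpose_sub, Matrix.transpose_mul, Matrix.transpose_transpose, hPsym,
      Matrix.mul_assoc, sub_sub_cancel]
  have hΓPΓ : Γ * P * Γᵀ = F * P * Fᵀ - K * (Gᵀ - Lᵀ) - (G - K) * Kᵀ := by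
    calc Γ * P * Γᵀ = Γ * P * Fᵀ - Γ * P * Hᵀ * Kᵀ := by
          conv_lhs => rw [hΓ, Matrix.transpose_sub, Matrix.transpose_mul, ← hΓ]
          rw [Matrix.mul_sub, Matrix.mul_assoc (Γ * P)]
      _ = F * P * Fᵀ - K * (H * P * Fᵀ) - Γ * P * Hᵀ * Kᵀ := by
          congr 1
          simp only [hΓ, Matrix.sub_mul, Matrix.mul_assoc]
      _ = _ := by rw [hHPF, hΓPH]
  have hmid : Γ * (P - P * Hᵀ * H * P) * Γᵀ = Γ * P * Γᵀ - (Γ * P * Hᵀ) * (H * P * Γᵀ) := by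
    simp only [Matrix.mul_sub, Matrix.sub_mul, Matrix.mul_assoc]
  rw [hmid, hΓPΓ, hΓPH, hHPΓ]
  refine hric.trans ?_
  simp only [Matrix.transpose_sub, Matrix.mul_sub, Matrix.sub_mul]
  abel
end
end
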